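/- Fix natural numbers n, m, a horizon N, a dynamics map f : ℕ → ℝⁿ → ℝᵐ → ℝⁿ, an input set U ⊆ ℝᵐ, a bounded disturbance set O ⊆ ℝⁿ, and a target tube T_0,…,T_N ⊆ ℝⁿ. Then for every k < N, the disturbance maximal reach set satisfies the backward recursion R̄_k(O) = T_k ∩ { x ∈ ℝⁿ : ∃ u ∈ U and ∃ o ∈ O such that f_k(x,u) + o ∈ R̄_{k+1}(O) }, i.e. R̄_k(O) equals the intersection of T_k with the one-step backward reach set of the Minkowski sum R̄_{k+1}(O) ⊕ (−O). -/

import Mathlib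

/-- Closed-loop trajectory: `traj f ν e k x j` is the state at time `k + j` of the system
`x_{t+1} = f_t(x_t, ν_t(x_t)) + e_t` started from state `x` at time `k`. -/
def traj {n m : ℕ} (f : ℕ → (Fin n → ℝ) → (Fin m → ℝ) → (Fin n → ℝ))
    (ν : ℕ → (Fin n → ℝ) → (Fin m → ℝ)) (e : ℕ → (Fin n → ℝ)) (k : ℕ) (x : Fin n → ℝ) :
    ℕ → (Fin n → ℝ)
  | 0 => x
  | j + 1 => f (k + j) (traj f ν e k x j) (ν (k + j) (traj f ν e k x j)) + e (k + j)

/-- The disturbance maximal reach set `R̄_k(O)` of the target tube `T_0, …, T_N`: states in `T_k`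
from which some admissible state-feedback policy together with some disturbance sequence with
values in `O` keeps the trajectory in the tube. -/
def ReachMax {n m : ℕ} (N : ℕ) (f : ℕ → (Fin n → ℝ) → (Fin m → ℝ) → (Fin n → ℝ))
    (U : Set (Fin m → ℝ)) (O : Set (Fin n → ℝ)) (T : ℕ → Set (Fin n → ℝ)) (k : ℕ) :
    Set (Fin n → ℝ) :=
  { x | x ∈ T k ∧ ∃ ν : ℕ → (Fin n → ℝ) → (Fin m → ℝ),
      (∀ t z, ν t z ∈ U) ∧
      ∃ e : ℕ → (Fin n → ℝ), (∀ t, k ≤ t → t < N → e t ∈ O) ∧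
        ∀ j, k + j ≤ N → traj f ν e k x j ∈ T (k + j) }

theorem traj_shift {n m : ℕ} (f : ℕ → (Fin n → ℝ) → (Fin m → ℝ) → (Fin n → ℝ))
    (ν : ℕ → (Fin n → ℝ) → (Fin m → ℝ)) (e : ℕ → (Fin n → ℝ)) (k : ℕ) (x : Fin n → ℝ) (j : ℕ) :
    traj f ν e k x (j + 1) = traj f ν e (k + 1) (f k x (ν k x) + e k) j := by
  induction j with
  | zero => simp [traj]
  | succ j ih =>
    rw [traj, ih, traj]
    have h : k + (j + 1) = k + 1 + j := by omega
    rw [h]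

theorem traj_congr {n m : ℕ} (f : ℕ → (Fin n → ℝ) → (Fin m → ℝ) → (Fin n → ℝ))
    (ν ν' : ℕ → (Fin n → ℝ) → (Fin m → ℝ)) (e e' : ℕ → (Fin n → ℝ)) (k : ℕ) (x : Fin n → ℝ)
    (hν : ∀ t, k ≤ t → ν t = ν' t) (he : ∀ t, k ≤ t → e t = e' t) (j : ℕ) :
    traj f ν e k x j = traj f ν' e' k x j := by
  induction j with
  | zero => rfl
  | succ j ih =>
    rw [traj, ih, traj, hν _ (Nat.le_add_right k j), he _ (Nat.le_add_right k j)]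

/-- Backward recursion for the disturbance maximal reach set:
`R̄_k(O) = T_k ∩ { x : ∃ u ∈ U, ∃ o ∈ O, f_k(x,u) + o ∈ R̄_{k+1}(O) }`. -/
theorem reachMax_backward_recursion {n m : ℕ} (N : ℕ)
    (f : ℕ → (Fin n → ℝ) → (Fin m → ℝ) → (Fin n → ℝ))
    (U : Set (Fin m → ℝ)) (O : Set (Fin n → ℝ)) (T : ℕ → Set (Fin n → ℝ))
    (k : ℕ) (hk : k < N) :
    ReachMax N f U O T k =
      T k ∩ { x | ∃ u ∈ U, ∃ o ∈ O, f k x u + o ∈ ReachMax N f U O T (k + 1) } := by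
  ext x
  constructor
  · rintro ⟨hx, ν, hν, e, he, hT⟩
    have key : ∀ j, k + 1 + j ≤ N →
        traj f ν e (k + 1) (f k x (ν k x) + e k) j ∈ T (k + 1 + j) := by
      intro j hj
      have h := hT (j + 1) (by omega)
      rw [traj_shift] at h
      have h' : k + (j + 1) = k + 1 + j := by omega
      rwa [h'] at h
    exact ⟨hx, ν k x, hν k x, e k, he k le_rfl hk, key 0 (by omega), ν, hν, e,
      fun t h1 h2 => he t (by omega) h2, key⟩
  · rintro ⟨hx, u, hu, o, ho, -, ν, hν, e, he, hT⟩
    refine ⟨hx, fun t z => if t = k then u else ν t z, ?_, fun t => if t = k then o else e t,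
      ?_, ?_⟩
    · intro t z
      dsimp only
      split_ifs
      · exact hu
      · exact hν t z
    · intro t h1 h2
      dsimp only
      split_ifs with h
      · exact ho
      · exact he t (by omega) h2
    · intro j hj
      cases j with
      | zero => exact hx
      | succ j =>
        have h' : k + (j + 1) = k + 1 + j := by omega
        have h := hT j (by omega)
        rw [traj_shift, h', traj_congr f _ ν _ e]
        · simpa using h
        · intro t ht
          funext z
          exact if_neg (by omega)
        · intro t ht
          exact if_neg (by omega)
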